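/- arXiv:2309.14644 — 2 statements merged into one kernel-verified Lean document; each statement's English description precedes it below -/
import Mathlib

section
/- Let x be a sock, let m ≥ 1, let l_1, …, l_m > 0 and l_{m+1} ≥ 0 be integers, and let s_1, …, s_m be nonempty sock sequences none of which contains the sock x. Let p be the concatenation x^{l_1} s_1 x^{l_2} s_2 ⋯ x^{l_m} s_m x^{l_{m+1}}, where x^l denotes l consecutive copies of x. Then φ_{aba}(p) = φ_{aba}(s_1) φ_{aba}(s_2) ⋯ φ_{aba}(s_m) x^{l_1 + l_2 + ⋯ + l_{m+1}}. -/
attribute [local instance] Classical.propDecidable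

/-- Two lists have the same shape: same length and identical equality pattern
of entries (`q_i = q_j` iff `r_i = r_j`). -/
def SameShape {A : Type*} {B : Type*} (q : List A) (r : List B) : Prop :=
  q.length = r.length ∧ ∀ i j : ℕ, (q[i]? = q[j]? ↔ r[i]? = r[j]?)

/-- `ContainsPat p σ` : the sock sequence `p` contains the pattern `σ`
(not necessarily consecutively): there are indices `i_1 < ⋯ < i_m` such that
`p_{i_j} = p_{i_k} ↔ σ_j = σ_k`. -/
def ContainsPat {A : Type*} {B : Type*} (p : List A) (σ : List B) : Prop :=
  ∃ q : List A, q.Sublist p ∧ SameShape q σ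

/-- A sock sequence is sorted if all occurrences of each sock appear
consecutively. -/
def SortedSocks {A : Type*} (p : List A) : Prop :=
  ∀ i j k : ℕ, i ≤ j → j ≤ k → p[i]? = p[k]? → p[j]? = p[i]?

/-- One pass of the deterministic σ-avoiding stack-sorting procedure:
`sortAux σ input stack` runs the σ-avoiding stack with the given remaining
input and current stack (stack listed from top to bottom), returning the rest
of the output.  If input remains and pushing the next input sock onto the
stack does not create a σ-pattern in the stack, that sock is pushed; otherwise
the top sock of the stack is popped to the output. -/
noncomputable def sortAux {A : Type*} {B : Type*} (σ : List B) : List A → List A → List A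
  | [], stack => stack
  | x :: input, stack =>
    if ContainsPat (x :: stack) σ then
      match stack with
      | [] => sortAux σ input [x]
      | t :: rest => t :: sortAux σ (x :: input) rest
    else
      sortAux σ input (x :: stack)
termination_by input stack => 2 * input.length + stack.length
decreasing_by all_goals simp only [List.length_cons]; omega

/-- The deterministic σ-avoiding stack-sorting map `φ_σ`. -/
noncomputable def phi {A : Type*} {B : Type*} (σ : List B) (p : List A) : List A :=
  sortAux σ p []

/-- The pattern `aba`: first and third socks equal, distinct from the second. -/
def abaPat : List ℕ := [0, 1, 0]

/-- Containing `aba` means having a sublist `[a, b, a]` with `a ≠ b`. -/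
theorem containsPat_abaPat_iff {A : Type*} (p : List A) :
    ContainsPat p abaPat ↔ ∃ a b, a ≠ b ∧ [a, b, a].Sublist p := by
  constructor
  · rintro ⟨q, hq, hlen, hshape⟩
    obtain ⟨a, b, c, rfl⟩ : ∃ a b c, q = [a, b, c] := by
      rw [← List.length_eq_three]
      exact hlen
    have hac : a = c := by simpa [abaPat] using hshape 0 2
    have hab : a ≠ b := by simpa [abaPat] using hshape 0 1
    subst hac
    exact ⟨a, b, hab, hq⟩
  · rintro ⟨a, b, hab, hsub⟩
    refine ⟨_, hsub, rfl, fun i j => ?_⟩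
    rcases i with _ | _ | _ | i <;> rcases j with _ | _ | _ | j <;>
      simp [abaPat, hab, hab.symm]

/-- Copies of a fresh sock at the bottom of the stack create no `aba`. -/
theorem containsPat_abaPat_append_replicate {A : Type*} {x : A} {t : List A} (hx : x ∉ t)
    (n : ℕ) : ContainsPat (t ++ List.replicate n x) abaPat ↔ ContainsPat t abaPat := by
  simp only [containsPat_abaPat_iff]
  constructor
  · rintro ⟨a, b, hab, hsub⟩
    refine ⟨a, b, hab, ?_⟩
    obtain ⟨u, v, huv, hu, hv⟩ := List.sublist_append_iff.mp hsub
    have hvx : ∀ y ∈ v, y = x := fun y hy => List.eq_of_mem_replicate (hv.subset hy)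
    have hux : ∀ y ∈ u, y ≠ x := fun y hy h => hx (h ▸ hu.subset hy)
    rcases v with _ | ⟨v₀, v⟩
    · rwa [huv, List.append_nil]
    · have hax : a = x := by
        have hlast := congrArg List.getLast? huv
        rw [List.getLast?_append_cons] at hlast
        exact hvx a (List.mem_of_getLast? (hlast.symm.trans rfl))
      rcases u with _ | ⟨u₀, u⟩
      · have hbx : b = x := hvx b (by rw [List.nil_append] at huv; simp [← huv])
        exact absurd (hax.trans hbx.symm) hab
      · have hau : a = u₀ := (List.cons.inj huv).1
        exact absurd hax (hux a (by simp [hau]))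
  · rintro ⟨a, b, hab, hsub⟩
    exact ⟨a, b, hab, hsub.trans (List.sublist_append_left _ _)⟩

theorem not_containsPat_abaPat_replicate {A : Type*} (x : A) (n : ℕ) :
    ¬ ContainsPat (List.replicate n x) abaPat := by
  rw [containsPat_abaPat_iff]
  rintro ⟨a, b, hab, hsub⟩
  exact hab ((List.eq_of_mem_replicate (hsub.subset (by simp))).trans
    (List.eq_of_mem_replicate (hsub.subset (by simp))).symm)

theorem sortAux_cons_of_not_containsPat {A B : Type*} {σ : List B} {y : A} {input stack : List A}
    (h : ¬ ContainsPat (y :: stack) σ) :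
    sortAux σ (y :: input) stack = sortAux σ input (y :: stack) := by
  rw [sortAux.eq_def]
  exact if_neg h

theorem sortAux_cons_of_containsPat {A B : Type*} {σ : List B} {y z : A} {input stack : List A}
    (h : ContainsPat (y :: z :: stack) σ) :
    sortAux σ (y :: input) (z :: stack) = z :: sortAux σ (y :: input) stack := by
  rw [sortAux, if_pos h]

/-- Copies of `x` are all pushed onto a stack consisting of copies of `x`. -/
theorem sortAux_abaPat_replicate_append {A : Type*} (x : A) (k n : ℕ) (r : List A) :
    sortAux abaPat (List.replicate k x ++ r) (List.replicate n x) =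
      sortAux abaPat r (List.replicate (n + k) x) := by
  induction k generalizing n with
  | zero => simp
  | succ k ih =>
    rw [List.replicate_succ, List.cons_append,
      sortAux_cons_of_not_containsPat (not_containsPat_abaPat_replicate x (n + 1)),
      ← List.replicate_succ, ih]
    congr 2
    omega

/-- If the remaining input `r` is empty or starts with `x`, the whole stack above the copies of `x`
is emptied before `r` is processed. -/
theorem sortAux_abaPat_append_stack {A : Type*} {x : A} {r : List A}
    (hr : ∀ y ∈ r.head?, y = x) (n : ℕ) {t : List A} (ht : x ∉ t) :
    sortAux abaPat r (t ++ List.replicate (n + 1) x) =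
      t ++ sortAux abaPat r (List.replicate (n + 1) x) := by
  rcases r with _ | ⟨y, r⟩
  · simp [sortAux]
  · obtain rfl : y = x := hr y (by simp)
    induction t with
    | nil => rfl
    | cons z t ih =>
      rw [List.mem_cons, not_or] at ht
      have hc : ContainsPat (y :: z :: (t ++ List.replicate (n + 1) y)) abaPat := by
        refine (containsPat_abaPat_iff _).mpr ⟨y, z, ht.1, ?_⟩
        simp [List.replicate_succ]
      rw [List.cons_append, sortAux_cons_of_containsPat hc, ih ht.2, List.cons_append]

/-- A block `s` without `x`, processed above copies of `x`, is sorted independently of them. -/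
theorem sortAux_abaPat_append {A : Type*} {x : A} {r : List A}
    (hr : ∀ y ∈ r.head?, y = x) (n : ℕ) {s t : List A} (hs : x ∉ s) (ht : x ∉ t) :
    sortAux abaPat (s ++ r) (t ++ List.replicate (n + 1) x) =
      sortAux abaPat s t ++ sortAux abaPat r (List.replicate (n + 1) x) := by
  induction s generalizing t with
  | nil => simpa [sortAux] using sortAux_abaPat_append_stack hr n ht
  | cons y s ih =>
    rw [List.mem_cons, not_or] at hs
    have hpush {t : List A} (ht : x ∉ t) (h : ¬ ContainsPat (y :: t) abaPat) :
        sortAux abaPat ((y :: s) ++ r) (t ++ List.replicate (n + 1) x) =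
          sortAux abaPat (y :: s) t ++ sortAux abaPat r (List.replicate (n + 1) x) := by
      have hyt : x ∉ y :: t := by simp [hs.1, ht]
      have h' := (containsPat_abaPat_append_replicate hyt (n + 1)).not.mpr h
      rw [List.cons_append] at h'
      rw [sortAux_cons_of_not_containsPat h, List.cons_append,
        sortAux_cons_of_not_containsPat h', ← List.cons_append, ih hs.2 hyt]
    induction t with
    | nil => exact hpush ht (not_containsPat_abaPat_replicate y 1)
    | cons z t iht =>
      by_cases h : ContainsPat (y :: z :: t) abaPat
      · have hyt : x ∉ y :: z :: t := List.not_mem_cons_of_ne_of_not_mem hs.1 ht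
        have h' := (containsPat_abaPat_append_replicate hyt (n + 1)).mpr h
        rw [List.cons_append, List.cons_append] at h'
        rw [sortAux_cons_of_containsPat h, List.cons_append, List.cons_append,
          sortAux_cons_of_containsPat h', ← List.cons_append,
          iht (List.not_mem_of_not_mem_cons ht), List.cons_append]
      · exact hpush ht h

/-- The action of the `aba`-stack on alternating blocks, started with copies of `x` on the stack. -/
theorem sortAux_abaPat_blocks {A : Type*} (x : A) (m : ℕ)
    (l : Fin (m + 1) → ℕ) (hl : ∀ i : Fin m, 0 < l i.castSucc)
    (s : Fin m → List A) (hsx : ∀ i, x ∉ s i) (n : ℕ) :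
    sortAux abaPat
      ((List.ofFn fun i : Fin m =>
          List.replicate (l i.castSucc) x ++ s i).flatten
        ++ List.replicate (l (Fin.last m)) x) (List.replicate n x)
    = (List.ofFn fun i : Fin m => phi abaPat (s i)).flatten
        ++ List.replicate (n + ∑ i : Fin (m + 1), l i) x := by
  induction m generalizing n with
  | zero =>
    have h := sortAux_abaPat_replicate_append x (l 0) n []
    simpa [sortAux] using h
  | succ m ih =>
    have ih' := ih (fun i => l i.succ) (fun i => hl i.succ) (fun i => s i.succ)
      (fun i => hsx i.succ) (n + l 0)
    rw [List.ofFn_succ, List.ofFn_succ, List.flatten_cons, List.flatten_cons, Fin.sum_univ_succ,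
      List.append_assoc, List.append_assoc, sortAux_abaPat_replicate_append, List.append_assoc,
      ← add_assoc, ← Fin.succ_last]
    simp only [← Fin.succ_castSucc, Fin.castSucc_zero] at ih' ⊢
    rw [← ih']
    obtain ⟨k, hk⟩ : ∃ k, n + l 0 = k + 1 :=
      Nat.exists_eq_add_one.mpr (Nat.add_pos_right n (hl 0))
    rw [hk]
    refine sortAux_abaPat_append (t := []) ?_ k (hsx 0) List.not_mem_nil
    intro y hy
    rcases m with _ | m
    · have hy' := List.mem_of_mem_head? hy
      simp only [List.ofFn_zero, List.flatten_nil, List.nil_append] at hy'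
      exact List.eq_of_mem_replicate hy'
    · obtain ⟨j, hj⟩ := Nat.exists_eq_add_one.mpr (hl (Fin.succ 0))
      rw [← Fin.succ_castSucc] at hj
      rw [List.ofFn_succ, hj] at hy
      simpa [List.replicate_succ, eq_comm] using hy

/-- Lemma (recursive action of the foot-sorting map): if
`p = x^{l_1} s_1 x^{l_2} s_2 ⋯ x^{l_m} s_m x^{l_{m+1}}` where `l_1,…,l_m > 0`,
`l_{m+1} ≥ 0`, and the `s_i` are nonempty sock sequences not containing the
sock `x`, then
`φ_{aba}(p) = φ_{aba}(s_1) φ_{aba}(s_2) ⋯ φ_{aba}(s_m) x^{l_1+⋯+l_{m+1}}`. -/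
theorem phi_aba_action {A : Type*} (x : A) (m : ℕ) (hm : 1 ≤ m)
    (l : Fin (m + 1) → ℕ) (hl : ∀ i : Fin m, 0 < l i.castSucc)
    (s : Fin m → List A) (hs : ∀ i, s i ≠ []) (hsx : ∀ i, x ∉ s i) :
    phi abaPat
      ((List.ofFn fun i : Fin m =>
          List.replicate (l i.castSucc) x ++ s i).flatten
        ++ List.replicate (l (Fin.last m)) x)
    = (List.ofFn fun i : Fin m => phi abaPat (s i)).flatten
        ++ List.replicate (∑ i : Fin (m + 1), l i) x := by
  simpa [phi] using sortAux_abaPat_blocks x m l hl s hsx 0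
end

section
/- If a sock sequence p is sorted, then φ_{aba}(p) is the reverse of p, and in particular φ_{aba}(p) is sorted. Hence sorted sock sequences remain sorted under applications of φ_{aba}. -/
attribute [local instance] Classical.propDecidable

theorem ContainsPat.mono {A B : Type*} {p q : List A} {σ : List B} (h : ContainsPat p σ)
    (hpq : p.Sublist q) : ContainsPat q σ := by
  obtain ⟨r, hr, hs⟩ := h
  exact ⟨r, hr.trans hpq, hs⟩

theorem sortAux_eq_of_not_containsPat {A B : Type*} {σ : List B} (input stack : List A)
    (h : ¬ ContainsPat (input.reverse ++ stack) σ) :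
    sortAux σ input stack = input.reverse ++ stack := by
  induction input generalizing stack with
  | nil => simp [sortAux]
  | cons x input ih =>
    have h_append : (x :: input).reverse ++ stack = input.reverse ++ x :: stack := by simp
    rw [h_append] at h ⊢
    have h_push : ¬ ContainsPat (x :: stack) σ :=
      fun hc => h (hc.mono (List.sublist_append_right _ _))
    rw [sortAux.eq_def]
    simp only [h_push, if_false]
    exact ih _ h

theorem SortedSocks.reverse {A : Type*} {p : List A} (hp : SortedSocks p) :
    SortedSocks p.reverse := by
  intro i j k hij hjk h
  by_cases hk : k < p.length
  · rw [List.getElem?_reverse (by omega), List.getElem?_reverse (by omega)] at h ⊢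
    rw [hp (p.length - 1 - k) (p.length - 1 - j) (p.length - 1 - i) (by omega) (by omega) h.symm,
      h]
  · have hi : p.length ≤ i := by
      rw [List.getElem?_eq_none (l := p.reverse) (i := k) (by simpa using hk)] at h
      simpa using h
    rw [List.getElem?_eq_none (by simpa using hi.trans hij),
      List.getElem?_eq_none (by simpa using hi)]

theorem SortedSocks.sublist {A : Type*} {p q : List A} (hp : SortedSocks p)
    (hqp : q.Sublist p) : SortedSocks q := by
  obtain ⟨f, hf⟩ := List.sublist_iff_exists_orderEmbedding_getElem?_eq.mp hqp
  intro i j k hij hjk h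
  rw [hf, hf] at h ⊢
  exact hp _ _ _ (f.monotone hij) (f.monotone hjk) h

theorem SortedSocks.not_containsPat_aba {A : Type*} {p : List A} (hp : SortedSocks p) :
    ¬ ContainsPat p abaPat := by
  rintro ⟨q, hqp, -, hq⟩
  have h_ends : q[0]? = q[2]? := (hq 0 2).mpr rfl
  have h_mid := (hq 1 0).mp (hp.sublist hqp 0 1 2 (by decide) (by decide) h_ends)
  simp [abaPat] at h_mid

/-- If a sock sequence `p` is sorted, then `φ_{aba}(p)` is the reverse of `p`;
in particular `φ_{aba}(p)` is sorted, so sorted sock sequences remain sorted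
under `φ_{aba}`. -/
theorem phi_aba_of_sorted {A : Type*} (p : List A) (hp : SortedSocks p) :
    phi abaPat p = p.reverse ∧ SortedSocks (phi abaPat p) := by
  have h_phi : phi abaPat p = p.reverse := by
    simpa [phi] using sortAux_eq_of_not_containsPat (σ := abaPat) p []
      (by simpa using hp.reverse.not_containsPat_aba)
  exact ⟨h_phi, h_phi ▸ hp.reverse⟩
end
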